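/- Let k ≥ 2, let G be a simple graph on a finite vertex set, and let r be a P_k^*-role colouring of G. Suppose u_0, u_1, …, u_{2k−1} are pairwise distinct vertices of G such that u_{i−1} is adjacent to u_i for every 1 ≤ i ≤ 2k−1, and such that deg_G(u_i) = 2 for every 1 ≤ i ≤ 2k−2. Then r(u_0) = r(u_{2k−1}). -/

import Mathlib

/-- Adjacency relation of the role graph `P_k^*`: the path on `Fin k`
with a loop at the end `k - 1`. -/
def pathStarAdj (k : ℕ) (i j : Fin k) : Prop :=
  (i.val + 1 = j.val ∨ j.val + 1 = i.val) ∨ (i = j ∧ i.val = k - 1)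

/-- An `A`-role colouring of `G`: the image of every open neighbourhood
equals the `A`-neighbourhood of the vertex's colour. -/
def IsRoleColoring {V : Type*} {k : ℕ} (G : SimpleGraph V)
    (A : Fin k → Fin k → Prop) (r : V → Fin k) : Prop :=
  ∀ v : V, r '' (G.neighborSet v) = {j : Fin k | A (r v) j}

/-- The colour at position `m` of the periodic walk `0, 1, …, k - 1, k - 1, …, 1, 0, …`
in `P_k^*`. -/
def foldedWalk (k m : ℕ) : ℕ :=
  min (m % (2 * k - 1)) (2 * k - 1 - m % (2 * k - 1))

theorem succ_mod_cases {n : ℕ} (hn : 0 < n) (m : ℕ) :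
    (m % n + 1 < n ∧ (m + 1) % n = m % n + 1) ∨ (m % n + 1 = n ∧ (m + 1) % n = 0) := by
  have hm := Nat.mod_lt m hn
  rw [← Nat.mod_add_mod]
  rcases Nat.lt_or_ge (m % n + 1) n with h | h
  · exact Or.inl ⟨h, Nat.mod_eq_of_lt h⟩
  · have h' : m % n + 1 = n := by omega
    exact Or.inr ⟨h', by rw [h', Nat.mod_self]⟩

theorem foldedWalk_add_period (k m : ℕ) :
    foldedWalk k (m + (2 * k - 1)) = foldedWalk k m := by
  simp [foldedWalk]

theorem exists_foldedWalk_of_adj {k : ℕ} (hk : 2 ≤ k) {x y : Fin k}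
    (h : pathStarAdj k x y) :
    ∃ s, foldedWalk k s = x ∧ foldedWalk k (s + 1) = y := by
  have hx := x.isLt
  have hy := y.isLt
  rcases h with (h | h) | ⟨rfl, h⟩
  · refine ⟨x, ?_⟩
    have h1 := succ_mod_cases (n := 2 * k - 1) (by omega) x.val
    have h2 : x.val % (2 * k - 1) = x.val := Nat.mod_eq_of_lt (by omega)
    unfold foldedWalk
    omega
  · refine ⟨2 * k - 1 - x, ?_⟩
    have h1 := succ_mod_cases (n := 2 * k - 1) (by omega) (2 * k - 1 - x.val)
    have h2 : (2 * k - 1 - x.val) % (2 * k - 1) = 2 * k - 1 - x.val :=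
      Nat.mod_eq_of_lt (by omega)
    unfold foldedWalk
    omega
  · refine ⟨k - 1, ?_⟩
    have h1 := succ_mod_cases (n := 2 * k - 1) (by omega) (k - 1)
    have h2 : (k - 1) % (2 * k - 1) = k - 1 := Nat.mod_eq_of_lt (by omega)
    unfold foldedWalk
    omega

theorem foldedWalk_step {k : ℕ} (hk : 2 ≤ k) {x y z : Fin k}
    (hyz : pathStarAdj k y z) (hall : ∀ j, pathStarAdj k y j → j = x ∨ j = z) {m : ℕ}
    (hx : foldedWalk k m = x) (hy : foldedWalk k (m + 1) = y) :
    foldedWalk k (m + 2) = z := by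
  have hm := Nat.mod_lt m (show 0 < 2 * k - 1 by omega)
  have h1 := succ_mod_cases (n := 2 * k - 1) (by omega) m
  have h2 := succ_mod_cases (n := 2 * k - 1) (by omega) (m + 1)
  have hup (h : y.val + 1 < k) : y.val + 1 = x ∨ y.val + 1 = z := by
    simpa [Fin.ext_iff] using hall ⟨y + 1, h⟩ (Or.inl (Or.inl rfl))
  have hdown (h : 1 ≤ y.val) : y.val - 1 = x ∨ y.val - 1 = z := by
    have hlt := y.isLt
    simpa [Fin.ext_iff] using
      hall ⟨y - 1, by omega⟩ (Or.inl (Or.inr (by simp only; omega)))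
  have hloop (h : y.val = k - 1) : y.val = x ∨ y.val = z := by
    simpa [Fin.ext_iff] using hall y (Or.inr ⟨rfl, h⟩)
  simp only [pathStarAdj, Fin.ext_iff] at hyz
  have hlt := y.isLt
  unfold foldedWalk at *
  rw [show m + 1 + 1 = m + 2 from rfl] at h2
  omega

theorem IsRoleColoring.adj {V : Type*} {k : ℕ} {G : SimpleGraph V}
    {A : Fin k → Fin k → Prop} {r : V → Fin k} (hr : IsRoleColoring G A r) {v w : V}
    (h : G.Adj v w) : A (r v) (r w) := by
  have hmem : r w ∈ r '' G.neighborSet v := ⟨w, h, rfl⟩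
  rwa [hr v] at hmem

theorem IsRoleColoring.eq_or_eq_of_degree_eq_two {V : Type*} [Fintype V] {k : ℕ}
    {G : SimpleGraph V} [DecidableRel G.Adj] {A : Fin k → Fin k → Prop} {r : V → Fin k}
    (hr : IsRoleColoring G A r) {v a b : V} (ha : G.Adj v a) (hb : G.Adj v b)
    (hab : a ≠ b) (hdeg : G.degree v = 2) (j : Fin k) (hj : A (r v) j) :
    j = r a ∨ j = r b := by
  classical
  have hmem : j ∈ r '' G.neighborSet v := by rw [hr v]; exact hj
  obtain ⟨w, hw, rfl⟩ := hmem
  have hsub : ({a, b} : Finset V) ⊆ G.neighborFinset v := by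
    simp [Finset.insert_subset_iff, ha, hb]
  have heq := Finset.eq_of_subset_of_card_le hsub (by
    rw [G.card_neighborFinset_eq_degree, hdeg, Finset.card_pair hab])
  have hw' : w ∈ ({a, b} : Finset V) := by
    rw [heq]
    simpa using hw
  rcases Finset.mem_insert.mp hw' with rfl | h
  · exact Or.inl rfl
  · exact Or.inr (congrArg r (Finset.mem_singleton.mp h))

theorem pathStar_role_coloring_period {V : Type*} [Fintype V]
    (G : SimpleGraph V) [DecidableRel G.Adj]
    (k : ℕ) (hk : 2 ≤ k) (r : V → Fin k)
    (hr : IsRoleColoring G (pathStarAdj k) r)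
    (u : ℕ → V)
    (hinj : ∀ i j : ℕ, i ≤ 2 * k - 1 → j ≤ 2 * k - 1 → u i = u j → i = j)
    (hadj : ∀ i : ℕ, 1 ≤ i → i ≤ 2 * k - 1 → G.Adj (u (i - 1)) (u i))
    (hdeg : ∀ i : ℕ, 1 ≤ i → i ≤ 2 * k - 2 → G.degree (u i) = 2) :
    r (u 0) = r (u (2 * k - 1)) := by
  have hadj' (i : ℕ) (hi : i + 1 ≤ 2 * k - 1) : G.Adj (u i) (u (i + 1)) :=
    hadj (i + 1) (by omega) hi
  obtain ⟨s, hs0, hs1⟩ := exists_foldedWalk_of_adj hk (hr.adj (hadj' 0 (by omega)))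
  have hwalk (i : ℕ) (hi : i + 1 ≤ 2 * k - 1) :
      foldedWalk k (s + i) = r (u i) ∧ foldedWalk k (s + i + 1) = r (u (i + 1)) := by
    induction i with
    | zero => exact ⟨hs0, hs1⟩
    | succ i ih =>
      obtain ⟨h1, h2⟩ := ih (by omega)
      refine ⟨h2, foldedWalk_step hk (hr.adj (hadj' (i + 1) hi)) ?_ h1 h2⟩
      refine hr.eq_or_eq_of_degree_eq_two (hadj' i (by omega)).symm (hadj' (i + 1) hi) ?_
        (hdeg (i + 1) (by omega) (by omega))
      intro h
      have := hinj i (i + 1 + 1) (by omega) hi h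
      omega
  have hlast := (hwalk (2 * k - 2) (by omega)).2
  rw [show s + (2 * k - 2) + 1 = s + (2 * k - 1) by omega,
    show 2 * k - 2 + 1 = 2 * k - 1 by omega, foldedWalk_add_period] at hlast
  exact Fin.ext (hs0.symm.trans hlast)
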